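/- Consider a BPRE whose environment takes exactly two values: P(Q=q₁)=r and P(Q=q₂)=1−r with r∈(0,1), where q₁(1)=1 and q₂(0)=p, q₂(2)=1−p with p∈(0,1). Then lim_{n→∞}(1/n)·log P₁(Zₙ=1) = log r, and liminf_{n→∞}(1/n)·log P₁(Zₙ=2) ≥ max{log r, log(2(1−r)(1−p)p)}. In particular, if r < 2p(1−p)/(1+2p(1−p)), then lim_{n→∞}(1/n)·log P₁(Zₙ=1) < liminf_{n→∞}(1/n)·log P₁(Zₙ=2). -/

import Mathlib

open MeasureTheory ProbabilityTheory Filter Topology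

noncomputable section

/-- `q` is a probability mass function on `ℕ`. -/
def IsPMF (q : ℕ → ℝ) : Prop := (∀ k, 0 ≤ q k) ∧ (∑' k, q k) = 1

/-- Mean `m_q` of a mass function on `ℕ`. -/
def pmfMean (q : ℕ → ℝ) : ℝ := ∑' k : ℕ, (k : ℝ) * q k

/-- `X = log m_Q`. -/
def envX (q : ℕ → ℝ) : ℝ := Real.log (pmfMean q)

/-- Probability generating function of `q`. -/
def pgf (q : ℕ → ℝ) (s : ℝ) : ℝ := ∑' k, q k * s ^ k

/-- Derivative `f'` of the probability generating function of `q`. -/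
def dpgf (q : ℕ → ℝ) (s : ℝ) : ℝ := ∑' k : ℕ, (k : ℝ) * q k * s ^ (k - 1)

/-- Second factorial moment `f''(1)` of `q`. -/
def pgf2 (q : ℕ → ℝ) : ℝ := ∑' k : ℕ, (k : ℝ) * ((k : ℝ) - 1) * q k

/-- Convolution of two mass functions on `ℕ`. -/
def conv (q r : ℕ → ℝ) (k : ℕ) : ℝ := ∑ j ∈ Finset.range (k + 1), q j * r (k - j)

/-- `z`-fold convolution power `q^{*z}`. -/
def convPow (q : ℕ → ℝ) : ℕ → ℕ → ℝ
  | 0 => fun k => if k = 0 then 1 else 0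
  | z + 1 => conv q (convPow q z)

/-- Quenched `n`-step transition probabilities of the branching process in the (varying)
environment `e`, where `e i` is the offspring distribution of generation `i + 1`:
`qtrans e n k j = P(Z_n = j | Z_0 = k, environment e)`. -/
def qtrans (e : ℕ → ℕ → ℝ) : ℕ → ℕ → ℕ → ℝ
  | 0, k, j => if j = k then 1 else 0
  | n + 1, k, j => ∑' i : ℕ, qtrans e n k i * convPow (e n) i j

/-- Composition `f_{i,n} = f_{i+1} ∘ ⋯ ∘ f_n` of generating functions, where `e m` is the
offspring distribution `Q_{m+1}`. -/
def Fcomp (e : ℕ → ℕ → ℝ) (i n : ℕ) (s : ℝ) : ℝ :=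
  (List.range (n - i)).foldr (fun m t => pgf (e (i + m)) t) s

/-- Extension of a finite environment to an infinite one (by a trivial environment). -/
def extEnv (n : ℕ) (e : Fin n → ℕ → ℝ) : ℕ → ℕ → ℝ := fun i =>
  if h : i < n then e ⟨i, h⟩ else fun k => if k = 1 then 1 else 0

/-- Law of the first `n` generations of an i.i.d. environment with marginal `ν`. -/
def envPi (ν : Measure (ℕ → ℝ)) [SigmaFinite ν] (n : ℕ) :
    Measure (Fin n → ℕ → ℝ) :=
  Measure.pi fun _ : Fin n => ν

/-- Annealed probability `P_k(Z_n = j)` of the BPRE whose environment is i.i.d. with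
marginal law `ν`. -/
def aP (ν : Measure (ℕ → ℝ)) [SigmaFinite ν] (n k j : ℕ) : ℝ :=
  ∫ e, qtrans (extEnv n e) n k j ∂(envPi ν n)

/-- The set `𝓘 = {j ≥ 1 : P(Q(j) > 0, Q(0) > 0) > 0}`. -/
def Iset (ν : Measure (ℕ → ℝ)) : Set ℕ :=
  {j | 1 ≤ j ∧ 0 < ν {q | 0 < q j ∧ 0 < q 0}}

/-- The set `Cl(𝓘)` of states reachable from `𝓘`. -/
def clI (ν : Measure (ℕ → ℝ)) [SigmaFinite ν] : Set ℕ :=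
  {k | 1 ≤ k ∧ ∃ n, ∃ j ∈ Iset ν, 0 < aP ν n j k}

/-- The set `Cl({z})` of states reachable from `z`. -/
def clz (ν : Measure (ℕ → ℝ)) [SigmaFinite ν] (z : ℕ) : Set ℕ :=
  {k | 1 ≤ k ∧ ∃ n, 0 < aP ν n z k}

/-- The spine (Geiger) expectation
`E[Q_n(z₀) f_{0,n}(0)^{z₀-1} ∏_{i=1}^{n-1} f_i'(f_{i,n}(0))]`. -/
def geigerExp (ν : Measure (ℕ → ℝ)) [SigmaFinite ν] (z₀ n : ℕ) : ℝ :=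
  ∫ e, (extEnv n e (n - 1)) z₀ * (Fcomp (extEnv n e) 0 n 0) ^ (z₀ - 1) *
      ∏ i ∈ Finset.Icc 1 (n - 1), dpgf (extEnv n e (i - 1)) (Fcomp (extEnv n e) i n 0)
    ∂(envPi ν n)

/-- `Λ(0) = - log inf_{λ ≥ 0} E[e^{-λ X}]`, the rate function of `S` at `0`. -/
def Lam0 (ν : Measure (ℕ → ℝ)) : ℝ :=
  - Real.log (sInf ((fun l : ℝ => ∫ q, Real.exp (-(l * envX q)) ∂ν) '' {l : ℝ | 0 ≤ l}))

/-- Truncated standardized second moment `ξ_q(a)`. -/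
def xi (q : ℕ → ℝ) (a : ℕ) : ℝ :=
  (∑' y : ℕ, if a ≤ y then (y : ℝ) ^ 2 * q y else 0) / (pmfMean q) ^ 2

/-- Assumption A2 : the random walk is non-lattice and a truncated moment condition holds. -/
def AssumptionA2 (ν : Measure (ℕ → ℝ)) : Prop :=
  (∀ r : ℝ, 0 < r → ν {q | ∃ m : ℤ, envX q = r * m} < 1) ∧
  ∃ ε : ℝ, 0 < ε ∧ ∃ a : ℕ, ∀ x : ℝ, 0 < x →
    IntegrableOn (fun q => Real.log (max (xi q a) 1) ^ ((2 : ℝ) + ε))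
      {q | -x < envX q} ν

/-- `q` has a linear fractional generating function with mean `m = pmfMean q` and
second derivative `b` at `1`. -/
def IsLF (q : ℕ → ℝ) : Prop :=
  0 < pmfMean q ∧ ∃ b : ℝ, 0 ≤ b ∧ ∀ s ∈ Set.Icc (0 : ℝ) 1,
    pgf q s = 1 - (1 - s) / ((pmfMean q)⁻¹ + b * ((pmfMean q) ^ 2)⁻¹ * (1 - s) / 2)

/-- A nonnegative function on `ℕ` with total mass one. -/
def Good (q : ℕ → ℝ) : Prop := (∀ k, 0 ≤ q k) ∧ HasSum q 1

lemma Good.le_one {q : ℕ → ℝ} (h : Good q) (k : ℕ) : q k ≤ 1 :=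
  le_hasSum h.2 k (fun j _ => h.1 j)

lemma good_single (a : ℕ) : Good (fun k => if k = a then 1 else 0) := by
  refine ⟨fun k => by positivity, ?_⟩
  exact hasSum_ite_eq a (1 : ℝ)

lemma good_conv {q r : ℕ → ℝ} (hq : Good q) (hr : Good r) : Good (conv q r) := by
  refine ⟨fun k => Finset.sum_nonneg fun j _ => mul_nonneg (hq.1 _) (hr.1 _), ?_⟩
  have h := hasSum_sum_range_mul_of_summable_norm (f := q) (g := r)
    hq.2.summable.norm hr.2.summable.norm
  rw [hq.2.tsum_eq, hr.2.tsum_eq, one_mul] at h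
  exact h

lemma good_convPow {q : ℕ → ℝ} (hq : Good q) (z : ℕ) : Good (convPow q z) := by
  induction z with
  | zero => exact good_single 0
  | succ z ih => exact good_conv hq ih

lemma good_qtrans {e : ℕ → ℕ → ℝ} (he : ∀ i, Good (e i)) (n k : ℕ) : Good (qtrans e n k) := by
  induction n with
  | zero => exact good_single k
  | succ n ih =>
    refine ⟨fun j => tsum_nonneg fun i => mul_nonneg (ih.1 i) ((good_convPow (he n) i).1 j), ?_⟩
    have hrow : ∀ i, HasSum (fun j => qtrans e n k i * convPow (e n) i j) (qtrans e n k i) := by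
      intro i
      simpa using (good_convPow (he n) i).2.mul_left (qtrans e n k i)
    have hs : Summable (fun x : ℕ × ℕ => qtrans e n k x.1 * convPow (e n) x.1 x.2) := by
      rw [summable_prod_of_nonneg
        (fun x => mul_nonneg (ih.1 x.1) ((good_convPow (he n) x.1).1 x.2))]
      refine ⟨fun i => (hrow i).summable, ?_⟩
      simp only [(hrow _).tsum_eq]
      exact ih.2.summable
    have h1 : ∑' x : ℕ × ℕ, qtrans e n k x.1 * convPow (e n) x.1 x.2 = 1 := by
      rw [hs.tsum_prod]
      simp only [(hrow _).tsum_eq]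
      exact ih.2.tsum_eq
    have h2 := (h1 ▸ hs.hasSum)
    have hs' := hs.prod_symm
    have h3 : HasSum (fun x : ℕ × ℕ => qtrans e n k x.2 * convPow (e n) x.2 x.1) 1 :=
      (Equiv.prodComm ℕ ℕ).hasSum_iff.mpr h2
    exact h3.prod_fiberwise (fun j => (hs'.prod_factor j).hasSum)

lemma qtrans_step {e : ℕ → ℕ → ℝ} (he : ∀ i, Good (e i)) (n k i j : ℕ) :
    qtrans e n k i * convPow (e n) i j ≤ qtrans e (n + 1) k j := by
  have hn := good_qtrans he n k
  have hnn : ∀ i, 0 ≤ qtrans e n k i * convPow (e n) i j :=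
    fun i => mul_nonneg (hn.1 i) ((good_convPow (he n) i).1 j)
  have hs : Summable (fun i => qtrans e n k i * convPow (e n) i j) :=
    Summable.of_nonneg_of_le hnn
      (fun i => mul_le_of_le_one_right (hn.1 i) ((good_convPow (he n) i).le_one j)) hn.2.summable
  exact hs.le_tsum i (fun i _ => hnn i)

/-- First environment. -/
def envA : ℕ → ℝ := fun k => if k = 1 then (1 : ℝ) else 0

/-- Second environment. -/
def envB (p : ℝ) : ℕ → ℝ := fun k => if k = 0 then p else if k = 2 then 1 - p else 0

lemma good_envA : Good envA := good_single 1

lemma good_envB {p : ℝ} (hp0 : 0 < p) (hp1 : p < 1) : Good (envB p) := by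
  constructor
  · intro k
    unfold envB
    split_ifs <;> linarith
  · have h : envB p = fun k => (if k = 0 then p else 0) + (if k = 2 then 1 - p else 0) := by
      funext k
      unfold envB
      by_cases h0 : k = 0
      · subst h0; simp
      · simp [h0]
    rw [h]
    have := (hasSum_ite_eq 0 p).add (hasSum_ite_eq 2 (1 - p))
    simpa using this

lemma convA (i : ℕ) : convPow envA i 1 = if i = 1 then envA 1 else 0 := by
  rcases i with _ | _ | i
  · simp [convPow]
  · simp [convPow, conv, envA, Finset.sum_range_succ]
  · simp [convPow, conv, envA, Finset.sum_range_succ]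

lemma convB (p : ℝ) (i : ℕ) : convPow (envB p) i 1 = if i = 1 then envB p 1 else 0 := by
  have h : convPow (envB p) i 1 = 0 := by
    induction i with
    | zero => simp [convPow]
    | succ i ih => simp [convPow, conv, Finset.sum_range_succ, ih, envB]
  rw [h]
  simp [envB]

lemma conv12 (q : ℕ → ℝ) : convPow q 1 2 = q 2 := by
  simp [convPow, conv, Finset.sum_range_succ]

lemma conv22 (q : ℕ → ℝ) : convPow q 2 2 = 2 * q 0 * q 2 + q 1 * q 1 := by
  simp [convPow, conv, Finset.sum_range_succ]
  ring

lemma qtrans11 {p : ℝ} {e : ℕ → ℕ → ℝ} (he : ∀ i, e i = envA ∨ e i = envB p) (n : ℕ) :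
    qtrans e n 1 1 = ∏ i ∈ Finset.range n, e i 1 := by
  induction n with
  | zero => simp [qtrans]
  | succ n ih =>
    have hc : ∀ i, convPow (e n) i 1 = if i = 1 then e n 1 else 0 := by
      intro i
      rcases he n with h | h <;> rw [h]
      · exact convA i
      · exact convB p i
    rw [Finset.prod_range_succ, ← ih]
    simp only [qtrans, hc]
    rw [tsum_eq_single 1]
    · simp
    · intro i hi; simp [hi]

lemma qtrans12 {e : ℕ → ℕ → ℝ} (he : ∀ i, Good (e i)) (n : ℕ) :
    e 0 2 * ∏ i ∈ Finset.range n, convPow (e (i + 1)) 2 2 ≤ qtrans e (n + 1) 1 2 := by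
  induction n with
  | zero =>
    have := qtrans_step he 0 1 1 2
    simpa [qtrans, conv12] using this
  | succ n ih =>
    rw [Finset.prod_range_succ, ← mul_assoc]
    exact (mul_le_mul_of_nonneg_right ih ((good_convPow (he (n + 1)) 2).1 2)).trans
      (qtrans_step he (n + 1) 1 2 2)

lemma aesm_of_finite {α : Type*} [MeasurableSpace α] [MeasurableSingletonClass α]
    {μ : Measure α} {S : Set α} (hS : S.Finite) (h : ∀ᵐ x ∂μ, x ∈ S) (f : α → ℝ) :
    AEStronglyMeasurable f μ := by
  classical
  have hm : Measurable (S.indicator f) := by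
    intro t _
    have : S.indicator f ⁻¹' t = (S ∩ f ⁻¹' t) ∪ (Sᶜ ∩ {_x | (0 : ℝ) ∈ t}) := by
      ext x
      by_cases hx : x ∈ S <;> simp [hx]
    rw [this]
    exact ((hS.inter_of_left _).measurableSet).union
      (hS.measurableSet.compl.inter (MeasurableSet.const _))
  refine ⟨S.indicator f, hm.stronglyMeasurable, ?_⟩
  filter_upwards [h] with x hx
  simp [hx]

section
variable {r p : ℝ} {ν : Measure (ℕ → ℝ)}

lemma int_nu (hr0 : 0 < r) (hr1 : r < 1)
    (hν : ν = ENNReal.ofReal r • Measure.dirac envA + ENNReal.ofReal (1 - r) • Measure.dirac (envB p))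
    (f : (ℕ → ℝ) → ℝ) : Integrable f ν ∧ ∫ q, f q ∂ν = r * f envA + (1 - r) * f (envB p) := by
  have h1 : Integrable f (ENNReal.ofReal r • Measure.dirac envA) :=
    (integrable_dirac (by simp)).smul_measure (by simp)
  have h2 : Integrable f (ENNReal.ofReal (1 - r) • Measure.dirac (envB p)) :=
    (integrable_dirac (by simp)).smul_measure (by simp)
  rw [hν]
  refine ⟨h1.add_measure h2, ?_⟩
  rw [integral_add_measure h1 h2, integral_smul_measure, integral_smul_measure,
    integral_dirac, integral_dirac, ENNReal.toReal_ofReal hr0.le,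
    ENNReal.toReal_ofReal (by linarith)]
  simp

lemma ae_nu
    (hν : ν = ENNReal.ofReal r • Measure.dirac envA + ENNReal.ofReal (1 - r) • Measure.dirac (envB p)) :
    ∀ᵐ q ∂ν, q = envA ∨ q = envB p := by
  rw [hν, ae_add_measure_iff]
  constructor
  · refine Measure.ae_smul_measure ?_ _
    rw [ae_dirac_eq]
    simp
  · refine Measure.ae_smul_measure ?_ _
    rw [ae_dirac_eq]
    simp

lemma ae_pi_nu [IsProbabilityMeasure ν]
    (hν : ν = ENNReal.ofReal r • Measure.dirac envA + ENNReal.ofReal (1 - r) • Measure.dirac (envB p))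
    (n : ℕ) : ∀ᵐ e ∂(envPi ν n), e ∈ Set.univ.pi (fun _ : Fin n => ({envA, envB p} : Set (ℕ → ℝ))) := by
  unfold envPi
  have : ∀ i : Fin n, ∀ᵐ e ∂(Measure.pi fun _ : Fin n => ν), e i = envA ∨ e i = envB p :=
    fun i => (Measure.tendsto_eval_ae_ae (μ := fun _ : Fin n => ν) (i := i)).eventually (ae_nu hν)
  filter_upwards [ae_all_iff.mpr this] with e he i _
  exact he i

lemma ext_mem {n : ℕ} {e : Fin n → ℕ → ℝ}
    (he : e ∈ Set.univ.pi (fun _ : Fin n => ({envA, envB p} : Set (ℕ → ℝ)))) (i : ℕ) :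
    extEnv n e i = envA ∨ extEnv n e i = envB p := by
  unfold extEnv
  split_ifs with h
  · exact he ⟨i, h⟩ trivial
  · exact Or.inl rfl

lemma ext_good (hp0 : 0 < p) (hp1 : p < 1) {n : ℕ} {e : Fin n → ℕ → ℝ}
    (he : e ∈ Set.univ.pi (fun _ : Fin n => ({envA, envB p} : Set (ℕ → ℝ)))) (i : ℕ) :
    Good (extEnv n e i) := by
  rcases ext_mem he i with h | h <;> rw [h]
  · exact good_envA
  · exact good_envB hp0 hp1

lemma extEnv_fin {n : ℕ} (e : Fin n → ℕ → ℝ) (i : Fin n) : extEnv n e i = e i := by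
  simp [extEnv]

lemma aP11 [IsProbabilityMeasure ν] (hr0 : 0 < r) (hr1 : r < 1)
    (hν : ν = ENNReal.ofReal r • Measure.dirac envA + ENNReal.ofReal (1 - r) • Measure.dirac (envB p))
    (n : ℕ) : aP ν n 1 1 = r ^ n := by
  have h : aP ν n 1 1 = ∫ e, ∏ i : Fin n, (fun q : ℕ → ℝ => q 1) (e i) ∂(envPi ν n) := by
    unfold aP
    refine integral_congr_ae ?_
    filter_upwards [ae_pi_nu hν n] with e he
    rw [qtrans11 (ext_mem he), Finset.prod_range]
    simp only [extEnv_fin]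
  rw [h, envPi, integral_fintype_prod_eq_pow (fun q : ℕ → ℝ => q 1), (int_nu hr0 hr1 hν _).2]
  simp [envA, envB]

lemma aP_bd [IsProbabilityMeasure ν] (hp0 : 0 < p) (hp1 : p < 1)
    (hν : ν = ENNReal.ofReal r • Measure.dirac envA + ENNReal.ofReal (1 - r) • Measure.dirac (envB p))
    (n k j : ℕ) : Integrable (fun e => qtrans (extEnv n e) n k j) (envPi ν n) ∧ aP ν n k j ≤ 1 := by
  have : IsProbabilityMeasure (envPi ν n) := by unfold envPi; infer_instance
  have hb : ∀ᵐ e ∂(envPi ν n), ‖qtrans (extEnv n e) n k j‖ ≤ 1 := by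
    filter_upwards [ae_pi_nu hν n] with e he
    have hg := good_qtrans (ext_good hp0 hp1 he) n k
    rw [Real.norm_of_nonneg (hg.1 j)]
    exact hg.le_one j
  have hfin : (Set.univ.pi (fun _ : Fin n => ({envA, envB p} : Set (ℕ → ℝ)))).Finite :=
    Set.Finite.pi fun _ => Set.toFinite _
  refine ⟨Integrable.of_bound (aesm_of_finite hfin (ae_pi_nu hν n) _) 1 hb, ?_⟩
  · have := norm_integral_le_of_norm_le_const hb
    simp only [probReal_univ, mul_one] at this
    exact (le_abs_self _).trans this

lemma aP12 [IsProbabilityMeasure ν] (hr0 : 0 < r) (hr1 : r < 1) (hp0 : 0 < p) (hp1 : p < 1)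
    (hν : ν = ENNReal.ofReal r • Measure.dirac envA + ENNReal.ofReal (1 - r) • Measure.dirac (envB p))
    (n : ℕ) : (1 - r) * (1 - p) * (r + (1 - r) * (2 * p * (1 - p))) ^ n ≤ aP ν (n + 1) 1 2 := by
  let φ : Fin (n + 1) → (ℕ → ℝ) → ℝ :=
    Fin.cons (fun q => q 2) (fun _ q => convPow q 2 2)
  have hi : Integrable (fun e : Fin (n + 1) → ℕ → ℝ => ∏ i, φ i (e i)) (envPi ν (n + 1)) :=
    Integrable.fintype_prod (fun i => (int_nu hr0 hr1 hν _).1)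
  have h1 : ∫ e, ∏ i, φ i (e i) ∂(envPi ν (n + 1)) =
      (1 - r) * (1 - p) * (r + (1 - r) * (2 * p * (1 - p))) ^ n := by
    rw [envPi, integral_fintype_prod_eq_prod, Fin.prod_univ_succ]
    simp only [φ, Fin.cons_zero, Fin.cons_succ, (int_nu hr0 hr1 hν _).2, conv22]
    simp [envA, envB]
  rw [← h1]
  refine integral_mono_ae hi (aP_bd hp0 hp1 hν _ _ _).1 ?_
  filter_upwards [ae_pi_nu hν (n + 1)] with e he
  refine le_trans (le_of_eq ?_) (qtrans12 (ext_good hp0 hp1 he) n)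
  rw [Fin.prod_univ_succ, Finset.prod_range]
  simp only [φ, Fin.cons_zero, Fin.cons_succ]
  congr 1
  refine Finset.prod_congr rfl fun i _ => ?_
  have := extEnv_fin e i.succ
  rw [Fin.val_succ] at this
  rw [this]

lemma liminf_bd {u : ℕ → ℝ} {c s : ℝ} (hc : 0 < c) (hs : 0 < s)
    (hl : ∀ n, c * s ^ n ≤ u (n + 1)) (hu : ∀ n, u n ≤ 1) :
    Real.log s ≤ Filter.liminf (fun n : ℕ => (1 / (n : ℝ)) * Real.log (u n)) atTop := by
  have hv : Tendsto (fun n : ℕ => (1 / (n : ℝ)) * Real.log (c / s) + Real.log s) atTop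
      (𝓝 (Real.log s)) := by
    have := (tendsto_one_div_atTop_nhds_zero_nat (𝕜 := ℝ)).mul_const (Real.log (c / s))
    simpa using this.add_const (Real.log s)
  rw [← hv.liminf_eq]
  refine liminf_le_liminf ?_ hv.isBoundedUnder_ge ?_
  · filter_upwards [eventually_ge_atTop 1] with n hn
    obtain ⟨m, rfl⟩ : ∃ m, n = m + 1 := ⟨n - 1, by omega⟩
    have hpos : (0 : ℝ) < ((m + 1 : ℕ) : ℝ) := by positivity
    have h2 : Real.log (c * s ^ m) ≤ Real.log (u (m + 1)) :=
      Real.log_le_log (by positivity) (hl m)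
    have h3 : Real.log (c * s ^ m) = Real.log (c / s) + ((m + 1 : ℕ) : ℝ) * Real.log s := by
      rw [Real.log_mul hc.ne' (by positivity), Real.log_pow, Real.log_div hc.ne' hs.ne']
      push_cast
      ring
    calc (1 / ((m + 1 : ℕ) : ℝ)) * Real.log (c / s) + Real.log s
        = (1 / ((m + 1 : ℕ) : ℝ)) * Real.log (c * s ^ m) := by rw [h3]; field_simp
      _ ≤ _ := by gcongr
  · refine IsBoundedUnder.isCoboundedUnder_ge (isBoundedUnder_of_eventually_le (a := 0) ?_)
    filter_upwards [eventually_ge_atTop 1] with n hn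
    obtain ⟨m, rfl⟩ : ∃ m, n = m + 1 := ⟨n - 1, by omega⟩
    have hpos : 0 ≤ u (m + 1) := le_trans (by positivity) (hl m)
    exact mul_nonpos_of_nonneg_of_nonpos (by positivity) (Real.log_nonpos hpos (hu _))

end

/-- Example 1 of Section 8. For the two-environment BPRE with
`P(Q = q₁) = r`, `P(Q = q₂) = 1 - r`, `q₁(1) = 1`, `q₂(0) = p`, `q₂(2) = 1 - p`:
`(1/n) log P₁(Zₙ = 1) → log r`,
`liminf (1/n) log P₁(Zₙ = 2) ≥ max(log r, log(2(1-r)(1-p)p))`, and if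
`r < 2p(1-p)/(1 + 2p(1-p))` then `lim (1/n) log P₁(Zₙ = 1) < liminf (1/n) log P₁(Zₙ = 2)`. -/
theorem stmt18 (r p : ℝ) (hr0 : 0 < r) (hr1 : r < 1) (hp0 : 0 < p) (hp1 : p < 1)
    (ν : Measure (ℕ → ℝ)) [IsProbabilityMeasure ν]
    (hν : ν = ENNReal.ofReal r • Measure.dirac (fun k => if k = 1 then (1 : ℝ) else 0)
        + ENNReal.ofReal (1 - r) •
            Measure.dirac (fun k => if k = 0 then p else if k = 2 then 1 - p else 0)) :
    Tendsto (fun n : ℕ => (1 / (n : ℝ)) * Real.log (aP ν n 1 1)) atTop (𝓝 (Real.log r)) ∧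
    max (Real.log r) (Real.log (2 * (1 - r) * (1 - p) * p))
      ≤ Filter.liminf (fun n : ℕ => (1 / (n : ℝ)) * Real.log (aP ν n 1 2)) atTop ∧
    (r < 2 * p * (1 - p) / (1 + 2 * p * (1 - p)) →
      Real.log r < Filter.liminf (fun n : ℕ => (1 / (n : ℝ)) * Real.log (aP ν n 1 2)) atTop) := by
  have hν' : ν = ENNReal.ofReal r • Measure.dirac envA
      + ENNReal.ofReal (1 - r) • Measure.dirac (envB p) := hν
  have hr1' : 0 < 1 - r := by linarith
  have hp1' : 0 < 1 - p := by linarith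
  have ht : 0 < (1 - r) * (2 * p * (1 - p)) := by positivity
  have hL := liminf_bd (u := fun n => aP ν n 1 2) (by positivity) (by positivity)
    (aP12 hr0 hr1 hp0 hp1 hν') (fun n => (aP_bd hp0 hp1 hν' n 1 2).2)
  have hlt : Real.log r < Real.log (r + (1 - r) * (2 * p * (1 - p))) :=
    Real.log_lt_log hr0 (by linarith)
  refine ⟨?_, ?_, fun _ => hlt.trans_le hL⟩
  · refine tendsto_const_nhds.congr' ?_
    filter_upwards [eventually_ge_atTop 1] with n hn
    have hn' : (n : ℝ) ≠ 0 := by positivity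
    rw [aP11 hr0 hr1 hν', Real.log_pow]
    field_simp
  · refine max_le (hlt.le.trans hL) (le_trans ?_ hL)
    refine Real.log_le_log (by positivity) ?_
    nlinarith

end
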